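/- arXiv:2012.06817 — 2 statements merged into one kernel-verified Lean document; each statement's English description precedes it below -/
import Mathlib

section
/- Let d ≥ 3. There exist constants C₁, C₂ > 0 depending only on d such that for every t > 0 and every Borel measurable V : ℝ^d → ℝ, C₁ · A(t) ≤ sup_{x∈ℝ^d} ∫_{|z-x| < √(4t)} |V(z)| / |z-x|^{d-2} dz ≤ C₂ · A(t), where A(t) = sup_{x∈ℝ^d} ∫_0^t ∫_{ℝ^d} g(s,x,z)|V(z)| dz ds. -/
open MeasureTheory Filter
open scoped ENNReal

/-- The Gauss-Weierstrass kernel on `ℝ^d`. -/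
noncomputable def gauss (d : ℕ) (t : ℝ) (x y : EuclideanSpace ℝ (Fin d)) : ℝ :=
  (4 * Real.pi * t) ^ (-(d : ℝ) / 2) * Real.exp (-‖y - x‖ ^ 2 / (4 * t))

/-- `S(V,t,x,y)`. -/
noncomputable def Sk (d : ℕ) (V : EuclideanSpace ℝ (Fin d) → ℝ) (t : ℝ)
    (x y : EuclideanSpace ℝ (Fin d)) : ℝ≥0∞ :=
  ∫⁻ s in Set.Ioo (0 : ℝ) t, ∫⁻ z,
    ENNReal.ofReal (gauss d s x z * gauss d (t - s) z y / gauss d t x y * |V z|)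

/-- `‖S(V,t)‖_∞`. -/
noncomputable def SNorm (d : ℕ) (V : EuclideanSpace ℝ (Fin d) → ℝ) (t : ℝ) : ℝ≥0∞ :=
  ⨆ x, ⨆ y, Sk d V t x y

/-- `‖S(V)‖_{T,∞}`. -/
noncomputable def SNormT (d : ℕ) (V : EuclideanSpace ℝ (Fin d) → ℝ) (T : ℝ) : ℝ≥0∞ :=
  ⨆ t ∈ Set.Ioc (0 : ℝ) T, SNorm d V t

/-- `sup_x ∫_0^t ∫ g(s,x,z)|V(z)| dz ds`. -/
noncomputable def katoA (d : ℕ) (V : EuclideanSpace ℝ (Fin d) → ℝ) (t : ℝ) : ℝ≥0∞ :=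
  ⨆ x, ∫⁻ s in Set.Ioo (0 : ℝ) t, ∫⁻ z, ENNReal.ofReal (gauss d s x z * |V z|)

lemma gauss_nonneg (d : ℕ) {s : ℝ} (hs : 0 ≤ s) (x z : EuclideanSpace ℝ (Fin d)) :
    0 ≤ gauss d s x z := by
  unfold gauss; positivity

lemma measurable_gauss_uncurry (d : ℕ) :
    Measurable fun p : ℝ × EuclideanSpace ℝ (Fin d) × EuclideanSpace ℝ (Fin d) =>
      gauss d p.1 p.2.1 p.2.2 := by
  unfold gauss; fun_prop

lemma ae_ne_of_three_le (d : ℕ) (hd : 3 ≤ d) (x : EuclideanSpace ℝ (Fin d)) :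
    ∀ᵐ z : EuclideanSpace ℝ (Fin d), z ≠ x := by
  have : Nonempty (Fin d) := ⟨⟨0, by omega⟩⟩
  exact Measure.ae_ne volume x

/-- The Gaussian kernel has total mass one. -/
lemma lintegral_gauss (d : ℕ) {s : ℝ} (hs : 0 < s) (x : EuclideanSpace ℝ (Fin d)) :
    ∫⁻ z, ENNReal.ofReal (gauss d s x z) = 1 := by
  have h1 : ∫ v : EuclideanSpace ℝ (Fin d), Real.exp (-(1 / (4 * s)) * ‖v‖ ^ 2) =
      (4 * Real.pi * s) ^ ((d : ℝ) / 2) := by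
    rw [GaussianFourier.integral_rexp_neg_mul_sq_norm (by positivity)]
    simp only [finrank_euclideanSpace, Fintype.card_fin]
    congr 1
    field_simp
  have hpos : 0 < (4 * Real.pi * s) ^ ((d : ℝ) / 2) := by positivity
  have hi : Integrable fun v : EuclideanSpace ℝ (Fin d) =>
      Real.exp (-(1 / (4 * s)) * ‖v‖ ^ 2) := by
    by_contra h
    rw [integral_undef h] at h1
    exact hpos.ne h1
  have h2 : ∀ z, ENNReal.ofReal (gauss d s x z) =
      ENNReal.ofReal ((4 * Real.pi * s) ^ (-(d : ℝ) / 2)) *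
        ENNReal.ofReal (Real.exp (-(1 / (4 * s)) * ‖z - x‖ ^ 2)) := by
    intro z
    rw [← ENNReal.ofReal_mul (by positivity)]
    unfold gauss
    congr 3
    ring
  simp_rw [h2]
  rw [lintegral_const_mul _ (by fun_prop),
    lintegral_sub_right_eq_self (fun v : EuclideanSpace ℝ (Fin d) =>
      ENNReal.ofReal (Real.exp (-(1 / (4 * s)) * ‖v‖ ^ 2))) x,
    ← ofReal_integral_eq_lintegral_ofReal hi (ae_of_all _ fun _ => (Real.exp_pos _).le), h1,
    ← ENNReal.ofReal_mul (by positivity), ← Real.rpow_add (by positivity)]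
  simp [neg_div]

/-- Below the parabolic scale, the time integral of the Gaussian kernel dominates the Newtonian
kernel. -/
lemma newtonian_le_lintegral_gauss (d : ℕ) {t : ℝ} {x z : EuclideanSpace ℝ (Fin d)}
    (hz : z ≠ x) (hzt : ‖z - x‖ < Real.sqrt (4 * t)) :
    ENNReal.ofReal (Real.pi ^ (-(d : ℝ) / 2) * Real.exp (-2) / 8 * (‖z - x‖ ^ ((d : ℝ) - 2))⁻¹) ≤
      ∫⁻ s in Set.Ioo 0 t, ENNReal.ofReal (gauss d s x z) := by
  have hr : 0 < ‖z - x‖ := norm_pos_iff.2 (sub_ne_zero.2 hz)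
  set r := ‖z - x‖ with hrdef
  have hrt : r ^ 2 < 4 * t := (Real.lt_sqrt hr.le).1 hzt
  have hid : Real.pi ^ (-(d : ℝ) / 2) * Real.exp (-2) / 8 * (r ^ ((d : ℝ) - 2))⁻¹ =
      (Real.pi * r ^ 2) ^ (-(d : ℝ) / 2) * Real.exp (-2) * (r ^ 2 / 4 - r ^ 2 / 8) := by
    rw [Real.mul_rpow (by positivity) (by positivity), ← Real.rpow_natCast r 2,
      ← Real.rpow_mul hr.le, ← Real.rpow_neg hr.le]
    have : r ^ (-((d : ℝ) - 2)) = r ^ (((2 : ℕ) : ℝ) * (-(d : ℝ) / 2)) * r ^ ((2 : ℕ) : ℝ) := by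
      rw [← Real.rpow_add hr]; congr 1; push_cast; ring
    rw [this]; ring
  calc _ = ∫⁻ _ in Set.Ioo (r ^ 2 / 8) (r ^ 2 / 4),
        ENNReal.ofReal ((Real.pi * r ^ 2) ^ (-(d : ℝ) / 2) * Real.exp (-2)) := by
        rw [setLIntegral_const, Real.volume_Ioo, ← ENNReal.ofReal_mul (by positivity), hid]
    _ ≤ ∫⁻ s in Set.Ioo (r ^ 2 / 8) (r ^ 2 / 4), ENNReal.ofReal (gauss d s x z) := by
        refine setLIntegral_mono' measurableSet_Ioo fun s hs => ENNReal.ofReal_le_ofReal ?_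
        have hs0 : 0 < s := lt_trans (by positivity) hs.1
        unfold gauss
        gcongr ?_ * ?_
        · refine Real.rpow_le_rpow_of_nonpos (by positivity) ?_ ?_
          · nlinarith [hs.2, Real.pi_pos]
          · have : (0 : ℝ) ≤ d := by positivity
            linarith
        · refine Real.exp_le_exp.2 ?_
          rw [neg_div, neg_le_neg_iff, div_le_iff₀ (by positivity)]
          linarith [hs.1]
    _ ≤ _ := by
        refine lintegral_mono_set (Set.Ioo_subset_Ioo (by positivity) (by linarith))

lemma rpow_half_le_factorial_mul_exp (d : ℕ) {u : ℝ} (hu : 0 ≤ u) :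
    u ^ ((d : ℝ) / 2) ≤ d.factorial * Real.exp u := by
  have hf : (1 : ℝ) ≤ d.factorial := by exact_mod_cast d.factorial_pos
  have hd : (0 : ℝ) ≤ d := by positivity
  rcases le_total u 1 with h | h
  · calc u ^ ((d : ℝ) / 2) ≤ 1 := Real.rpow_le_one hu h (by positivity)
      _ ≤ d.factorial * Real.exp u := one_le_mul_of_one_le_of_one_le hf (Real.one_le_exp hu)
  · calc u ^ ((d : ℝ) / 2) ≤ u ^ (d : ℝ) := Real.rpow_le_rpow_of_exponent_le h (by linarith)
      _ = u ^ d := Real.rpow_natCast _ _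
      _ ≤ d.factorial * Real.exp u := by
        have := Real.pow_div_factorial_le_exp u hu d
        rwa [div_le_iff₀' (by positivity)] at this

/-- The time integral of the Gaussian kernel is dominated by the Newtonian kernel. -/
lemma lintegral_gauss_le_newtonian (d : ℕ) (hd : 3 ≤ d) (t : ℝ) {x z : EuclideanSpace ℝ (Fin d)}
    (hz : z ≠ x) :
    ∫⁻ s in Set.Ioo 0 t, ENNReal.ofReal (gauss d s x z) ≤
      ENNReal.ofReal ((d.factorial + 2) * (‖z - x‖ ^ ((d : ℝ) - 2))⁻¹) := by
  have hr : 0 < ‖z - x‖ := norm_pos_iff.2 (sub_ne_zero.2 hz)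
  have hd' : (3 : ℝ) ≤ d := by exact_mod_cast hd
  set r := ‖z - x‖ with hrdef
  have hpi := Real.pi_gt_three
  have hrr : (r ^ ((d : ℝ) - 2))⁻¹ = (r ^ 2) ^ (-(d : ℝ) / 2) * r ^ 2 := by
    rw [← Real.rpow_natCast r 2, ← Real.rpow_mul hr.le, ← Real.rpow_neg hr.le, ← Real.rpow_add hr]
    congr 1; push_cast; ring
  have hsmall : ∫⁻ s in Set.Ioc 0 (r ^ 2), ENNReal.ofReal (gauss d s x z) ≤
      ENNReal.ofReal (d.factorial * (r ^ ((d : ℝ) - 2))⁻¹) := by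
    calc _ ≤ ∫⁻ _ in Set.Ioc 0 (r ^ 2),
          ENNReal.ofReal (d.factorial * (r ^ 2) ^ (-(d : ℝ) / 2)) := by
          refine setLIntegral_mono' measurableSet_Ioc fun s hs => ENNReal.ofReal_le_ofReal ?_
          have hs0 : 0 < s := hs.1
          have hu : 0 < r ^ 2 / (4 * s) := by positivity
          unfold gauss
          rw [← hrdef, neg_div (4 * s), Real.exp_neg]
          have h1 := rpow_half_le_factorial_mul_exp d hu.le
          have h2 : (4 * Real.pi * s) ^ (-(d : ℝ) / 2) ≤ (4 * s) ^ (-(d : ℝ) / 2) :=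
            Real.rpow_le_rpow_of_nonpos (by positivity) (by nlinarith) (by linarith)
          have h3 : (4 * s) ^ (-(d : ℝ) / 2) =
              (r ^ 2) ^ (-(d : ℝ) / 2) * (r ^ 2 / (4 * s)) ^ ((d : ℝ) / 2) := by
            rw [Real.div_rpow (by positivity) (by positivity), neg_div,
              Real.rpow_neg (by positivity), Real.rpow_neg (by positivity)]
            field_simp
          rw [← div_eq_mul_inv, div_le_iff₀ (Real.exp_pos _)]
          calc _ ≤ _ := h2
            _ = _ := h3
            _ ≤ (r ^ 2) ^ (-(d : ℝ) / 2) * (d.factorial * Real.exp (r ^ 2 / (4 * s))) := by gcongr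
            _ = _ := by ring
      _ = _ := by
          rw [setLIntegral_const, Real.volume_Ioc, ← ENNReal.ofReal_mul (by positivity), hrr]
          congr 1; ring
  have hlarge : ∫⁻ s in Set.Ioi (r ^ 2), ENNReal.ofReal (gauss d s x z) ≤
      ENNReal.ofReal (2 * (r ^ ((d : ℝ) - 2))⁻¹) := by
    have hr2 : 0 < r ^ 2 := by positivity
    have hlt : -(d : ℝ) / 2 < -1 := by linarith
    calc _ ≤ ∫⁻ s in Set.Ioi (r ^ 2), ENNReal.ofReal (s ^ (-(d : ℝ) / 2)) := by
          refine setLIntegral_mono' measurableSet_Ioi fun s hs => ENNReal.ofReal_le_ofReal ?_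
          have hs0 : 0 < s := hr2.trans hs
          unfold gauss
          calc _ ≤ (4 * Real.pi * s) ^ (-(d : ℝ) / 2) * 1 := by
                gcongr
                rw [Real.exp_le_one_iff, neg_div, neg_nonpos]
                positivity
            _ ≤ _ := by
                rw [mul_one]
                exact Real.rpow_le_rpow_of_nonpos hs0 (by nlinarith) (by linarith)
      _ = ENNReal.ofReal (∫ s in Set.Ioi (r ^ 2), s ^ (-(d : ℝ) / 2)) := by
          rw [ofReal_integral_eq_lintegral_ofReal (integrableOn_Ioi_rpow_of_lt hlt hr2)]
          refine (ae_restrict_iff' measurableSet_Ioi).2 (ae_of_all _ fun s hs => ?_)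
          exact Real.rpow_nonneg (hr2.trans hs).le _
      _ ≤ _ := by
          refine ENNReal.ofReal_le_ofReal ?_
          rw [integral_Ioi_rpow_of_lt hlt hr2, hrr, Real.rpow_add_one hr2.ne']
          have hP : 0 ≤ (r ^ 2) ^ (-(d : ℝ) / 2) * r ^ 2 := by positivity
          rw [← neg_div_neg_eq, neg_neg, div_le_iff₀ (by linarith)]
          nlinarith
  calc _ ≤ ∫⁻ s in Set.Ioc 0 (r ^ 2) ∪ Set.Ioi (r ^ 2), ENNReal.ofReal (gauss d s x z) := by
        refine lintegral_mono_set fun s hs => ?_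
        rcases le_or_gt s (r ^ 2) with h | h
        · exact Or.inl ⟨hs.1, h⟩
        · exact Or.inr h
    _ ≤ _ := lintegral_union_le _ _ _
    _ ≤ _ := add_le_add hsmall hlarge
    _ = _ := by
        rw [← ENNReal.ofReal_add (by positivity) (by positivity)]
        congr 1; ring

lemma gauss_le_of_norm_le (d : ℕ) {s : ℝ} (hs : 0 < s) {x y z : EuclideanSpace ℝ (Fin d)}
    (h : ‖y - x‖ ≤ 2 * ‖z - x‖) : gauss d s x z ≤ 2 ^ d * gauss d (4 * s) x y := by
  have h4 : (4 * Real.pi * s) ^ (-(d : ℝ) / 2) =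
      2 ^ d * (4 * Real.pi * (4 * s)) ^ (-(d : ℝ) / 2) := by
    have : (4 * Real.pi * (4 * s)) = 2 ^ (2 : ℝ) * (4 * Real.pi * s) := by norm_num; ring
    rw [this, Real.mul_rpow (x := 2 ^ (2 : ℝ)) (by positivity) (by positivity),
      ← Real.rpow_mul (by norm_num),
      ← Real.rpow_natCast 2 d, ← mul_assoc, ← Real.rpow_add (by norm_num)]
    ring_nf
    simp
  unfold gauss
  rw [h4, mul_assoc]
  gcongr 2 ^ d * (_ * ?_)
  rw [Real.exp_le_exp, neg_div, neg_div, neg_le_neg_iff, div_le_div_iff₀ (by positivity)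
    (by positivity)]
  have : ‖y - x‖ ^ 2 ≤ (2 * ‖z - x‖) ^ 2 := by gcongr
  nlinarith

/-- A uniform bound on the mass of balls of radius `ρ` controls Gaussian integrals away from the
centre. -/
lemma lintegral_gauss_compl_ball_le (d : ℕ) {s ρ : ℝ} (hs : 0 < s)
    {W : EuclideanSpace ℝ (Fin d) → ℝ≥0∞} (hW : Measurable W) {M : ℝ≥0∞}
    (hM : ∀ y, ∫⁻ z in Metric.ball y ρ, W z ≤ M) (x : EuclideanSpace ℝ (Fin d)) :
    volume (Metric.ball (0 : EuclideanSpace ℝ (Fin d)) ρ) *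
      ∫⁻ z in (Metric.ball x ρ)ᶜ, ENNReal.ofReal (gauss d s x z) * W z ≤ 2 ^ d * M := by
  have hmg : Measurable fun y => ENNReal.ofReal (gauss d (4 * s) x y) :=
    ((measurable_gauss_uncurry d).comp (by fun_prop :
      Measurable fun y : EuclideanSpace ℝ (Fin d) => (4 * s, x, y))).ennreal_ofReal
  have hset : MeasurableSet
      {p : EuclideanSpace ℝ (Fin d) × EuclideanSpace ℝ (Fin d) | dist p.2 p.1 < ρ} :=
    measurableSet_lt (by fun_prop) (by fun_prop)
  have hpt : ∀ z ∈ (Metric.ball x ρ)ᶜ,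
      volume (Metric.ball (0 : EuclideanSpace ℝ (Fin d)) ρ) *
        (ENNReal.ofReal (gauss d s x z) * W z) ≤
      ∫⁻ y, {p : EuclideanSpace ℝ (Fin d) × EuclideanSpace ℝ (Fin d) | dist p.2 p.1 < ρ}.indicator
        (fun p => 2 ^ d * ENNReal.ofReal (gauss d (4 * s) x p.2) * W p.1) (z, y) := by
    intro z hz
    have hz' : ρ ≤ ‖z - x‖ := by
      simpa [Metric.mem_ball, dist_eq_norm] using hz
    calc _ = ∫⁻ _ in Metric.ball z ρ, ENNReal.ofReal (gauss d s x z) * W z := by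
          rw [setLIntegral_const, mul_comm, Measure.addHaar_ball_center volume z]
      _ ≤ ∫⁻ y in Metric.ball z ρ, 2 ^ d * ENNReal.ofReal (gauss d (4 * s) x y) * W z := by
          refine setLIntegral_mono' measurableSet_ball fun y hy => ?_
          gcongr
          have hy' : ‖y - z‖ < ρ := by rwa [Metric.mem_ball, dist_eq_norm] at hy
          have h2 : ‖y - x‖ ≤ 2 * ‖z - x‖ := by
            have := norm_add_le (y - z) (z - x)
            rw [sub_add_sub_cancel] at this
            linarith
          refine (ENNReal.ofReal_le_ofReal (gauss_le_of_norm_le d hs h2)).trans_eq ?_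
          rw [ENNReal.ofReal_mul (by positivity), ENNReal.ofReal_pow (by norm_num)]
          norm_num
      _ = _ := by
          rw [← lintegral_indicator measurableSet_ball]
          rfl
  have hmeas : Measurable
      ({p : EuclideanSpace ℝ (Fin d) × EuclideanSpace ℝ (Fin d) | dist p.2 p.1 < ρ}.indicator
        (fun p => 2 ^ d * ENNReal.ofReal (gauss d (4 * s) x p.2) * W p.1)) :=
    (((hmg.comp measurable_snd).const_mul _).mul (hW.comp measurable_fst)).indicator hset
  have hvol : volume (Metric.ball (0 : EuclideanSpace ℝ (Fin d)) ρ) ≠ ⊤ := measure_ball_lt_top.ne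
  calc _ = ∫⁻ z in (Metric.ball x ρ)ᶜ, volume (Metric.ball (0 : EuclideanSpace ℝ (Fin d)) ρ) *
        (ENNReal.ofReal (gauss d s x z) * W z) := (lintegral_const_mul' _ _ hvol).symm
    _ ≤ ∫⁻ z in (Metric.ball x ρ)ᶜ, ∫⁻ y,
        {p : EuclideanSpace ℝ (Fin d) × EuclideanSpace ℝ (Fin d) | dist p.2 p.1 < ρ}.indicator
        (fun p => 2 ^ d * ENNReal.ofReal (gauss d (4 * s) x p.2) * W p.1) (z, y) :=
        setLIntegral_mono' measurableSet_ball.compl hpt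
    _ ≤ ∫⁻ z, ∫⁻ y,
        {p : EuclideanSpace ℝ (Fin d) × EuclideanSpace ℝ (Fin d) | dist p.2 p.1 < ρ}.indicator
        (fun p => 2 ^ d * ENNReal.ofReal (gauss d (4 * s) x p.2) * W p.1) (z, y) :=
        setLIntegral_le_lintegral _ _
    _ = ∫⁻ y, ∫⁻ z,
        {p : EuclideanSpace ℝ (Fin d) × EuclideanSpace ℝ (Fin d) | dist p.2 p.1 < ρ}.indicator
        (fun p => 2 ^ d * ENNReal.ofReal (gauss d (4 * s) x p.2) * W p.1) (z, y) :=
        lintegral_lintegral_swap hmeas.aemeasurable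
    _ = ∫⁻ y, 2 ^ d * ENNReal.ofReal (gauss d (4 * s) x y) * ∫⁻ z in Metric.ball y ρ, W z := by
        refine lintegral_congr fun y => ?_
        rw [← lintegral_const_mul _ hW, ← lintegral_indicator measurableSet_ball]
        refine lintegral_congr fun z => ?_
        by_cases h : dist z y < ρ <;> simp [Set.indicator, dist_comm y z, h]
    _ ≤ ∫⁻ y, 2 ^ d * ENNReal.ofReal (gauss d (4 * s) x y) * M := by
        gcongr with y
        exact hM y
    _ = 2 ^ d * M := by
        rw [lintegral_mul_const _ (hmg.const_mul _), lintegral_const_mul _ hmg,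
          lintegral_gauss d (by positivity), mul_one]

theorem stmt11 (d : ℕ) (hd : 3 ≤ d) :
    ∃ C₁ C₂ : ℝ, 0 < C₁ ∧ 0 < C₂ ∧
    ∀ t : ℝ, 0 < t → ∀ V : EuclideanSpace ℝ (Fin d) → ℝ, Measurable V →
      ENNReal.ofReal C₁ * katoA d V t ≤
        (⨆ x, ∫⁻ z in {z : EuclideanSpace ℝ (Fin d) | ‖z - x‖ < Real.sqrt (4 * t)},
          ENNReal.ofReal (|V z| / ‖z - x‖ ^ ((d : ℝ) - 2))) ∧
      (⨆ x, ∫⁻ z in {z : EuclideanSpace ℝ (Fin d) | ‖z - x‖ < Real.sqrt (4 * t)},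
          ENNReal.ofReal (|V z| / ‖z - x‖ ^ ((d : ℝ) - 2))) ≤
        ENNReal.ofReal C₂ * katoA d V t := by
  have hd' : (3 : ℝ) ≤ d := by exact_mod_cast hd
  have hv0 : volume (Metric.ball (0 : EuclideanSpace ℝ (Fin d)) 1) ≠ 0 :=
    (Metric.measure_ball_pos _ _ one_pos).ne'
  have hvt : volume (Metric.ball (0 : EuclideanSpace ℝ (Fin d)) 1) ≠ ⊤ := measure_ball_lt_top.ne
  obtain ⟨v, hv, hvv⟩ : ∃ v : ℝ, 0 < v ∧
      volume (Metric.ball (0 : EuclideanSpace ℝ (Fin d)) 1) = ENNReal.ofReal v :=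
    ⟨_, ENNReal.toReal_pos hv0 hvt, (ENNReal.ofReal_toReal hvt).symm⟩
  set c : ℝ := Real.pi ^ (-(d : ℝ) / 2) * Real.exp (-2) / 8
  have hcpos : 0 < c := by positivity
  set K : ℝ := (d.factorial + 2) + 2 ^ d / (4 * v)
  have hKpos : 0 < K := by positivity
  refine ⟨K⁻¹, c⁻¹, by positivity, by positivity, fun t ht V hV => ?_⟩
  set ρ := Real.sqrt (4 * t)
  have hρ : 0 < ρ := Real.sqrt_pos.2 (by positivity)
  have hρ2 : ρ ^ 2 = 4 * t := Real.sq_sqrt (by positivity)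
  have hball : ∀ x : EuclideanSpace ℝ (Fin d), {z | ‖z - x‖ < ρ} = Metric.ball x ρ := by
    intro x; ext z; simp [dist_eq_norm]
  simp only [hball]
  set W : EuclideanSpace ℝ (Fin d) → ℝ≥0∞ := fun z => ENNReal.ofReal |V z|
  have hW : Measurable W := by fun_prop
  have hN : ∀ x z : EuclideanSpace ℝ (Fin d), ENNReal.ofReal (|V z| / ‖z - x‖ ^ ((d : ℝ) - 2)) =
      ENNReal.ofReal (‖z - x‖ ^ ((d : ℝ) - 2))⁻¹ * W z := by
    intro x z
    rw [div_eq_mul_inv, mul_comm, ENNReal.ofReal_mul (by positivity)]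
  have hgm : ∀ x : EuclideanSpace ℝ (Fin d), Measurable fun p : ℝ × EuclideanSpace ℝ (Fin d) =>
      ENNReal.ofReal (gauss d p.1 x p.2) := fun x =>
    ((measurable_gauss_uncurry d).comp (by fun_prop :
      Measurable fun p : ℝ × EuclideanSpace ℝ (Fin d) => (p.1, x, p.2))).ennreal_ofReal
  have hA : katoA d V t =
      ⨆ x, ∫⁻ s in Set.Ioo 0 t, ∫⁻ z, ENNReal.ofReal (gauss d s x z) * W z := by
    unfold katoA
    refine iSup_congr fun x => setLIntegral_congr_fun measurableSet_Ioo fun s hs => ?_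
    exact lintegral_congr fun z => ENNReal.ofReal_mul (gauss_nonneg d hs.1.le x z)
  have hswap : ∀ (x : EuclideanSpace ℝ (Fin d)) (S : Set (EuclideanSpace ℝ (Fin d))),
      ∫⁻ s in Set.Ioo 0 t, ∫⁻ z in S, ENNReal.ofReal (gauss d s x z) * W z =
      ∫⁻ z in S, (∫⁻ s in Set.Ioo 0 t, ENNReal.ofReal (gauss d s x z)) * W z := by
    intro x S
    rw [lintegral_lintegral_swap ((hgm x).mul (hW.comp measurable_snd)).aemeasurable]
    refine lintegral_congr fun z => lintegral_mul_const _ ?_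
    exact (hgm x).comp (by fun_prop : Measurable fun s : ℝ => (s, z))
  simp only [hN]
  set B := ⨆ x, ∫⁻ z in Metric.ball x ρ, ENNReal.ofReal (‖z - x‖ ^ ((d : ℝ) - 2))⁻¹ * W z
    with hB
  have hinv : ∀ {a : ℝ} {X Y : ℝ≥0∞}, 0 < a → ENNReal.ofReal a * X ≤ Y →
      X ≤ ENNReal.ofReal a⁻¹ * Y := by
    intro a X Y ha h
    calc X = ENNReal.ofReal a⁻¹ * (ENNReal.ofReal a * X) := by
          rw [← mul_assoc, ← ENNReal.ofReal_mul (by positivity), inv_mul_cancel₀ ha.ne']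
          simp
      _ ≤ _ := by gcongr
  constructor
  · rw [hA]
    suffices h : (⨆ x, ∫⁻ s in Set.Ioo 0 t, ∫⁻ z, ENNReal.ofReal (gauss d s x z) * W z) ≤
        ENNReal.ofReal K * B by
      calc _ ≤ ENNReal.ofReal K⁻¹ * (ENNReal.ofReal K * B) := by gcongr
        _ = B := by
          rw [← mul_assoc, ← ENNReal.ofReal_mul (by positivity), inv_mul_cancel₀ hKpos.ne']
          simp
    refine iSup_le fun x => ?_
    have hmass : ∀ y, ∫⁻ z in Metric.ball y ρ, W z ≤ ENNReal.ofReal (ρ ^ ((d : ℝ) - 2)) * B := by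
      intro y
      calc _ ≤ ∫⁻ z in Metric.ball y ρ, ENNReal.ofReal (ρ ^ ((d : ℝ) - 2)) *
            (ENNReal.ofReal (‖z - y‖ ^ ((d : ℝ) - 2))⁻¹ * W z) := by
            refine lintegral_mono_ae ?_
            filter_upwards [ae_restrict_mem measurableSet_ball,
              ae_restrict_of_ae (ae_ne_of_three_le d hd y)] with z hz hne
            rw [← mul_assoc, ← ENNReal.ofReal_mul (by positivity)]
            refine le_mul_of_one_le_left zero_le ?_
            rw [ENNReal.one_le_ofReal, ← div_eq_mul_inv]
            have hr : 0 < ‖z - y‖ := norm_pos_iff.2 (sub_ne_zero.2 hne)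
            rw [one_le_div (by positivity)]
            rw [Metric.mem_ball, dist_eq_norm] at hz
            exact Real.rpow_le_rpow hr.le hz.le (by linarith)
        _ = ENNReal.ofReal (ρ ^ ((d : ℝ) - 2)) * _ := lintegral_const_mul' _ _ (by simp)
        _ ≤ _ := by
            gcongr
            exact le_iSup (fun x => ∫⁻ z in Metric.ball x ρ,
              ENNReal.ofReal (‖z - x‖ ^ ((d : ℝ) - 2))⁻¹ * W z) y
    have hnear : ∫⁻ s in Set.Ioo 0 t, ∫⁻ z in Metric.ball x ρ,
        ENNReal.ofReal (gauss d s x z) * W z ≤ ENNReal.ofReal (d.factorial + 2) * B := by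
      rw [hswap]
      calc _ ≤ ∫⁻ z in Metric.ball x ρ, ENNReal.ofReal (d.factorial + 2) *
            (ENNReal.ofReal (‖z - x‖ ^ ((d : ℝ) - 2))⁻¹ * W z) := by
            refine lintegral_mono_ae ?_
            filter_upwards [ae_restrict_of_ae (ae_ne_of_three_le d hd x)] with z hne
            rw [← mul_assoc, ← ENNReal.ofReal_mul (by positivity)]
            gcongr
            exact lintegral_gauss_le_newtonian d hd t hne
        _ = ENNReal.ofReal (d.factorial + 2) * _ := lintegral_const_mul' _ _ (by simp)
        _ ≤ _ := by
            gcongr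
            exact le_iSup (fun x => ∫⁻ z in Metric.ball x ρ,
              ENNReal.ofReal (‖z - x‖ ^ ((d : ℝ) - 2))⁻¹ * W z) x
    have hfar : ∫⁻ s in Set.Ioo 0 t, ∫⁻ z in (Metric.ball x ρ)ᶜ,
        ENNReal.ofReal (gauss d s x z) * W z ≤ ENNReal.ofReal (2 ^ d / (4 * v)) * B := by
      have hvol : volume (Metric.ball (0 : EuclideanSpace ℝ (Fin d)) ρ) =
          ENNReal.ofReal (ρ ^ d * v) := by
        rw [Measure.addHaar_ball_of_pos _ _ hρ, hvv, finrank_euclideanSpace, Fintype.card_fin,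
          ← ENNReal.ofReal_mul (by positivity)]
      calc _ ≤ ∫⁻ _ in Set.Ioo 0 t, ENNReal.ofReal (ρ ^ d * v)⁻¹ *
            (2 ^ d * (ENNReal.ofReal (ρ ^ ((d : ℝ) - 2)) * B)) := by
            refine setLIntegral_mono' measurableSet_Ioo fun s hs => hinv (by positivity) ?_
            rw [← hvol]
            exact lintegral_gauss_compl_ball_le d hs.1 hW hmass x
        _ = _ := by
            rw [setLIntegral_const, Real.volume_Ioo, sub_zero]
            have h2 : (2 : ℝ≥0∞) ^ d = ENNReal.ofReal (2 ^ d) := by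
              rw [ENNReal.ofReal_pow (by norm_num)]; norm_num
            rw [h2, mul_comm _ (ENNReal.ofReal t), ← mul_assoc, ← mul_assoc, ← mul_assoc,
              ← ENNReal.ofReal_mul (by positivity), ← ENNReal.ofReal_mul (by positivity),
              ← ENNReal.ofReal_mul (by positivity)]
            congr 2
            have h3 : ρ ^ ((d : ℝ) - 2) = ρ ^ d / (4 * t) := by
              rw [Real.rpow_sub hρ, Real.rpow_natCast, Real.rpow_two, hρ2]
            rw [h3]
            field_simp
    calc _ = ∫⁻ s in Set.Ioo 0 t, ((∫⁻ z in Metric.ball x ρ, ENNReal.ofReal (gauss d s x z) * W z) +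
          ∫⁻ z in (Metric.ball x ρ)ᶜ, ENNReal.ofReal (gauss d s x z) * W z) :=
          lintegral_congr fun s => (lintegral_add_compl _ measurableSet_ball).symm
      _ = _ := lintegral_add_left
          (((hgm x).mul (hW.comp measurable_snd)).lintegral_prod_right') _
      _ ≤ _ := add_le_add hnear hfar
      _ = _ := by rw [← add_mul, ← ENNReal.ofReal_add (by positivity) (by positivity)]
  · refine hinv hcpos ?_
    rw [hA, hB, ENNReal.mul_iSup]
    refine iSup_mono fun x => ?_
    calc _ = ∫⁻ z in Metric.ball x ρ, ENNReal.ofReal c *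
          (ENNReal.ofReal (‖z - x‖ ^ ((d : ℝ) - 2))⁻¹ * W z) :=
          (lintegral_const_mul' _ _ (by simp)).symm
      _ ≤ ∫⁻ z in Metric.ball x ρ, (∫⁻ s in Set.Ioo 0 t, ENNReal.ofReal (gauss d s x z)) * W z := by
          refine lintegral_mono_ae ?_
          filter_upwards [ae_restrict_mem measurableSet_ball,
            ae_restrict_of_ae (ae_ne_of_three_le d hd x)] with z hz hne
          rw [← mul_assoc, ← ENNReal.ofReal_mul (by positivity)]
          gcongr
          rw [Metric.mem_ball, dist_eq_norm] at hz
          exact newtonian_le_lintegral_gauss d hne hz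
      _ ≤ ∫⁻ z, (∫⁻ s in Set.Ioo 0 t, ENNReal.ofReal (gauss d s x z)) * W z :=
          setLIntegral_le_lintegral _ _
      _ = _ := by
          have := hswap x Set.univ
          simp only [Measure.restrict_univ] at this
          exact this.symm
end

section
/- Let d = 2. There exist constants C₁, C₂ > 0 such that for every t > 0 and every Borel measurable V : ℝ² → ℝ, C₁ · A(t) ≤ sup_{x∈ℝ²} ∫_{|z-x| < √(4t)} |V(z)| · log(4t / |z-x|²) dz ≤ C₂ · A(t), where A(t) = sup_{x∈ℝ²} ∫_0^t ∫_{ℝ²} g(s,x,z)|V(z)| dz ds. -/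
open MeasureTheory Filter
open scoped ENNReal

lemma gauss_two (s : ℝ) (x z : EuclideanSpace ℝ (Fin 2)) :
    gauss 2 s x z = (4 * Real.pi * s)⁻¹ * Real.exp (-‖z - x‖ ^ 2 / (4 * s)) := by
  have h : (-((2 : ℕ) : ℝ) / 2) = -1 := by norm_num
  rw [gauss, h, Real.rpow_neg_one]

lemma gauss_two_le {s : ℝ} (x z : EuclideanSpace ℝ (Fin 2)) (hs : 0 < s) :
    gauss 2 s x z ≤ s⁻¹ * Real.exp (-‖z - x‖ ^ 2 / (4 * s)) := by
  rw [gauss_two]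
  gcongr
  nlinarith [Real.pi_gt_three]

lemma measurable_gauss (d : ℕ) (x : EuclideanSpace ℝ (Fin d)) :
    Measurable fun p : ℝ × EuclideanSpace ℝ (Fin d) => gauss d p.1 x p.2 := by
  unfold gauss
  fun_prop

lemma lintegral_Ioo_inv {a b : ℝ} (ha : 0 < a) (hab : a ≤ b) :
    ∫⁻ s in Set.Ioo a b, ENNReal.ofReal s⁻¹ = ENNReal.ofReal (Real.log (b / a)) := by
  have hb := ha.trans_le hab
  have hi : IntervalIntegrable (fun s : ℝ => s⁻¹) volume a b :=
    intervalIntegral.intervalIntegrable_inv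
      (fun s hs => by
        rw [Set.uIcc_of_le hab] at hs
        exact (ha.trans_le hs.1).ne')
      continuousOn_id
  rw [← integral_inv_of_pos ha hb, intervalIntegral.integral_of_le hab,
    ofReal_integral_eq_lintegral_ofReal
      ((intervalIntegrable_iff_integrableOn_Ioc_of_le hab).1 hi)]
  · exact setLIntegral_congr Ioo_ae_eq_Ioc
  · filter_upwards [ae_restrict_mem measurableSet_Ioc] with s hs
    exact inv_nonneg.2 (ha.trans hs.1).le

lemma ofReal_log_le_lintegral_gauss {t : ℝ} (ht : 0 < t) (x z : EuclideanSpace ℝ (Fin 2))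
    (hz : ‖z - x‖ < Real.sqrt (4 * t)) :
    ENNReal.ofReal (Real.log (4 * t / ‖z - x‖ ^ 2)) ≤
      ENNReal.ofReal (4 * Real.pi * Real.exp 1) *
        ∫⁻ s in Set.Ioo 0 t, ENNReal.ofReal (gauss 2 s x z) := by
  rcases (norm_nonneg (z - x)).eq_or_lt with h0 | h0
  · simp [← h0]
  have hr : ‖z - x‖ ^ 2 < 4 * t := (Real.lt_sqrt h0.le).1 hz
  have hr0 : 0 < ‖z - x‖ ^ 2 := by positivity
  have hlog : 4 * t / ‖z - x‖ ^ 2 = t / (‖z - x‖ ^ 2 / 4) := by field_simp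
  rw [hlog, ← lintegral_Ioo_inv (by positivity) (by linarith),
    ← lintegral_const_mul' _ _ ENNReal.ofReal_ne_top]
  refine (setLIntegral_mono' measurableSet_Ioo fun s hs => ?_).trans
    (lintegral_mono_set (Set.Ioo_subset_Ioo_left (by positivity)))
  have hs0 : 0 < s := lt_trans (by positivity) hs.1
  rw [← ENNReal.ofReal_mul (by positivity)]
  apply ENNReal.ofReal_le_ofReal
  rw [gauss_two]
  have h1 : Real.exp (-1) ≤ Real.exp (-‖z - x‖ ^ 2 / (4 * s)) := by
    rw [Real.exp_le_exp, le_div_iff₀ (by positivity)]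
    linarith [hs.1]
  calc s⁻¹ = s⁻¹ * (Real.exp 1 * Real.exp (-1)) := by rw [← Real.exp_add]; simp
    _ ≤ s⁻¹ * (Real.exp 1 * Real.exp (-‖z - x‖ ^ 2 / (4 * s))) := by gcongr
    _ = _ := by field_simp

lemma lintegral_gauss_le_log {t : ℝ} (x z : EuclideanSpace ℝ (Fin 2))
    (h0 : 0 < ‖z - x‖) (hz : ‖z - x‖ ^ 2 < t) :
    ∫⁻ s in Set.Ioo 0 t, ENNReal.ofReal (gauss 2 s x z) ≤
      2 * ENNReal.ofReal (Real.log (4 * t / ‖z - x‖ ^ 2)) := by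
  set r := ‖z - x‖ ^ 2 with hr
  have hr0 : 0 < r := by positivity
  have hsub : Set.Ioo 0 t ⊆ Set.Ioc 0 (r / 4) ∪ Set.Ioo (r / 4) t := by
    intro s hs
    rcases le_or_gt s (r / 4) with h | h
    · exact Or.inl ⟨hs.1, h⟩
    · exact Or.inr ⟨h, hs.2⟩
  have hlog : 4 * t / r = t / (r / 4) := by field_simp
  have hone : 1 ≤ Real.log (4 * t / r) := by
    rw [Real.le_log_iff_exp_le (by have := hr0.trans hz; positivity), le_div_iff₀ hr0]
    nlinarith [Real.exp_one_lt_d9]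
  have hsmall : ∫⁻ s in Set.Ioc 0 (r / 4), ENNReal.ofReal (gauss 2 s x z) ≤ 1 := by
    calc ∫⁻ s in Set.Ioc 0 (r / 4), ENNReal.ofReal (gauss 2 s x z)
        ≤ ∫⁻ _ in Set.Ioc 0 (r / 4), ENNReal.ofReal (4 / r) := by
          refine setLIntegral_mono' measurableSet_Ioc fun s hs => ENNReal.ofReal_le_ofReal ?_
          have hs0 := hs.1
          refine (gauss_two_le x z hs0).trans ?_
          rw [← hr, neg_div, Real.exp_neg, ← mul_inv, inv_le_comm₀ (by positivity) (by positivity)]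
          calc (4 / r)⁻¹ = s * (r / (4 * s)) := by field_simp
            _ ≤ s * Real.exp (r / (4 * s)) := by
              gcongr
              linarith [Real.add_one_le_exp (r / (4 * s))]
      _ = 1 := by
          rw [setLIntegral_const, Real.volume_Ioc, ← ENNReal.ofReal_mul (by positivity)]
          have h1 : 4 / r * (r / 4 - 0) = 1 := by field_simp; ring
          rw [h1, ENNReal.ofReal_one]
  have hlarge : ∫⁻ s in Set.Ioo (r / 4) t, ENNReal.ofReal (gauss 2 s x z) ≤
      ENNReal.ofReal (Real.log (4 * t / r)) := by
    rw [hlog, ← lintegral_Ioo_inv (by positivity) (by linarith)]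
    refine setLIntegral_mono' measurableSet_Ioo fun s hs => ENNReal.ofReal_le_ofReal ?_
    have hs0 : 0 < s := lt_trans (by positivity) hs.1
    refine (gauss_two_le x z hs0).trans (mul_le_of_le_one_right (by positivity) ?_)
    rw [Real.exp_le_one_iff, neg_div]
    exact neg_nonpos.2 (by positivity)
  calc _ ≤ ∫⁻ s in Set.Ioc 0 (r / 4) ∪ Set.Ioo (r / 4) t, ENNReal.ofReal (gauss 2 s x z) :=
        lintegral_mono_set hsub
    _ ≤ _ := lintegral_union_le _ _ _
    _ ≤ ENNReal.ofReal (Real.log (4 * t / r)) + ENNReal.ofReal (Real.log (4 * t / r)) :=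
        add_le_add (hsmall.trans (by simpa using ENNReal.ofReal_le_ofReal hone)) hlarge
    _ = _ := (two_mul _).symm

lemma lintegral_gauss_le_exp {t : ℝ} (ht : 0 < t) (x z : EuclideanSpace ℝ (Fin 2))
    (hz : t ≤ ‖z - x‖ ^ 2) :
    ∫⁻ s in Set.Ioo 0 t, ENNReal.ofReal (gauss 2 s x z) ≤
      8 * ENNReal.ofReal (Real.exp (-‖z - x‖ ^ 2 / (8 * t))) := by
  set r := ‖z - x‖ ^ 2 with hr
  have hr0 : 0 < r := ht.trans_le hz
  calc ∫⁻ s in Set.Ioo 0 t, ENNReal.ofReal (gauss 2 s x z)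
      ≤ ∫⁻ _ in Set.Ioo 0 t, ENNReal.ofReal (8 / t * Real.exp (-r / (8 * t))) := by
        refine setLIntegral_mono' measurableSet_Ioo fun s hs => ENNReal.ofReal_le_ofReal ?_
        have hs0 := hs.1
        refine (gauss_two_le x z hs0).trans ?_
        have hsplit : -r / (4 * s) = -(r / (8 * s)) + -(r / (8 * s)) := by field_simp; ring
        rw [← hr, hsplit, Real.exp_add, ← mul_assoc]
        gcongr
        · rw [Real.exp_neg, ← mul_inv, inv_le_comm₀ (by positivity) (by positivity)]
          calc (8 / t)⁻¹ = t / 8 := by rw [inv_div]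
            _ ≤ r / 8 := by gcongr
            _ = s * (r / (8 * s)) := by field_simp
            _ ≤ s * Real.exp (r / (8 * s)) := by
              gcongr
              linarith [Real.add_one_le_exp (r / (8 * s))]
        · rw [neg_div]
          gcongr
          exact hs.2.le
    _ = _ := by
        rw [setLIntegral_const, Real.volume_Ioo, ← ENNReal.ofReal_mul (by positivity),
          ← ENNReal.ofReal_ofNat 8, ← ENNReal.ofReal_mul (by positivity)]
        congr 1
        field_simp
        ring

/-- A Gaussian is dominated by the local averages of a wider Gaussian. -/
lemma ofReal_exp_le_setLIntegral_ball {t : ℝ} (ht : 0 < t) (x z : EuclideanSpace ℝ (Fin 2)) :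
    ENNReal.ofReal (Real.exp (-‖z - x‖ ^ 2 / (8 * t))) ≤
      ENNReal.ofReal (Real.exp 1 / (Real.pi * t)) *
        ∫⁻ c in Metric.ball z (Real.sqrt t),
          ENNReal.ofReal (Real.exp (-(16 * t)⁻¹ * ‖c - x‖ ^ 2)) := by
  calc ENNReal.ofReal (Real.exp (-‖z - x‖ ^ 2 / (8 * t)))
      = ENNReal.ofReal (Real.exp 1 / (Real.pi * t)) *
        ∫⁻ _ in Metric.ball z (Real.sqrt t),
          ENNReal.ofReal (Real.exp (-1) * Real.exp (-‖z - x‖ ^ 2 / (8 * t))) := by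
        rw [setLIntegral_const, EuclideanSpace.volume_ball_fin_two,
          ← ENNReal.ofReal_pow (Real.sqrt_nonneg t), Real.sq_sqrt ht.le]
        rw [← ENNReal.ofReal_mul (by positivity), ← ENNReal.ofReal_mul (by positivity),
          ← ENNReal.ofReal_mul (by positivity)]
        congr 1
        rw [Real.exp_neg]
        field_simp
    _ ≤ _ := by
        gcongr _ * ?_
        refine setLIntegral_mono' measurableSet_ball fun c hc => ENNReal.ofReal_le_ofReal ?_
        rw [← Real.exp_add, Real.exp_le_exp]
        have hc' : ‖c - z‖ < Real.sqrt t := by simpa [dist_eq_norm] using hc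
        have hc2 : ‖c - z‖ ^ 2 < t := (Real.lt_sqrt (norm_nonneg _)).1 hc'
        have htri : ‖c - x‖ ≤ ‖c - z‖ + ‖z - x‖ := norm_sub_le_norm_sub_add_norm_sub c z x
        have hsq : ‖c - x‖ ^ 2 ≤ 2 * t + 2 * ‖z - x‖ ^ 2 := by
          nlinarith [norm_nonneg (c - x), sq_nonneg (‖c - z‖ - ‖z - x‖)]
        have : (16 * t)⁻¹ * ‖c - x‖ ^ 2 ≤ (16 * t)⁻¹ * (2 * t + 2 * ‖z - x‖ ^ 2) := by gcongr
        have h2 : (16 * t)⁻¹ * (2 * t + 2 * ‖z - x‖ ^ 2) = 1 / 8 + ‖z - x‖ ^ 2 / (8 * t) := by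
          field_simp
          ring
        rw [neg_div, neg_mul]
        linarith

lemma lintegral_exp_neg_mul_norm_sub_sq {t : ℝ} (ht : 0 < t) (x : EuclideanSpace ℝ (Fin 2)) :
    ∫⁻ c, ENNReal.ofReal (Real.exp (-(16 * t)⁻¹ * ‖c - x‖ ^ 2)) =
      ENNReal.ofReal (16 * Real.pi * t) := by
  rw [lintegral_sub_right_eq_self
    (fun c => ENNReal.ofReal (Real.exp (-(16 * t)⁻¹ * ‖c‖ ^ 2))) x]
  have hval := GaussianFourier.integral_rexp_neg_mul_sq_norm
    (V := EuclideanSpace ℝ (Fin 2)) (b := (16 * t)⁻¹) (by positivity)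
  have heq : (Real.pi / (16 * t)⁻¹) ^
      ((Module.finrank ℝ (EuclideanSpace ℝ (Fin 2)) : ℝ) / 2) = 16 * Real.pi * t := by
    simp [div_eq_mul_inv]
    ring
  rw [heq] at hval
  have hint : Integrable fun c : EuclideanSpace ℝ (Fin 2) =>
      Real.exp (-(16 * t)⁻¹ * ‖c‖ ^ 2) := by
    by_contra h
    rw [integral_undef h] at hval
    have : 0 < 16 * Real.pi * t := by positivity
    linarith
  rw [← hval, ofReal_integral_eq_lintegral_ofReal hint]
  exact .of_forall fun c => (Real.exp_pos _).le

/-- If `V` has mass at most `M` on every ball of radius `√t`, then its integral against a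
Gaussian of width comparable to `√t` is bounded by a multiple of `M`. -/
lemma lintegral_mul_exp_le {t : ℝ} (ht : 0 < t) {W : EuclideanSpace ℝ (Fin 2) → ℝ≥0∞}
    (hW : Measurable W) {M : ℝ≥0∞}
    (hM : ∀ c, ∫⁻ z in Metric.ball c (Real.sqrt t), W z ≤ M) (x : EuclideanSpace ℝ (Fin 2)) :
    ∫⁻ z, W z * ENNReal.ofReal (Real.exp (-‖z - x‖ ^ 2 / (8 * t))) ≤
      ENNReal.ofReal (16 * Real.exp 1) * M := by
  set K := ENNReal.ofReal (Real.exp 1 / (Real.pi * t)) with hK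
  set e : EuclideanSpace ℝ (Fin 2) → ℝ≥0∞ :=
    fun c => ENNReal.ofReal (Real.exp (-(16 * t)⁻¹ * ‖c - x‖ ^ 2)) with he
  have hem : Measurable e := by fun_prop
  have hS : MeasurableSet {p : EuclideanSpace ℝ (Fin 2) × EuclideanSpace ℝ (Fin 2) |
      dist p.1 p.2 < Real.sqrt t} :=
    measurableSet_lt (by fun_prop) measurable_const
  calc ∫⁻ z, W z * ENNReal.ofReal (Real.exp (-‖z - x‖ ^ 2 / (8 * t)))
      ≤ ∫⁻ z, W z * (K * ∫⁻ c in Metric.ball z (Real.sqrt t), e c) := by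
        gcongr with z
        exact ofReal_exp_le_setLIntegral_ball ht x z
    _ = ∫⁻ z, K * ∫⁻ c, {p : EuclideanSpace ℝ (Fin 2) × EuclideanSpace ℝ (Fin 2) |
          dist p.1 p.2 < Real.sqrt t}.indicator (fun p => W p.1 * e p.2) (z, c) := by
        refine lintegral_congr fun z => ?_
        rw [mul_left_comm, ← lintegral_const_mul _ hem,
          ← lintegral_indicator measurableSet_ball]
        congr 1
        refine lintegral_congr fun c => ?_
        by_cases h : dist z c < Real.sqrt t
        · rw [Set.indicator_of_mem (Metric.mem_ball'.2 h), Set.indicator_of_mem (by exact h)]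
        · rw [Set.indicator_of_notMem (mt Metric.mem_ball'.1 h),
            Set.indicator_of_notMem (by exact h)]
    _ = K * ∫⁻ c, ∫⁻ z, {p : EuclideanSpace ℝ (Fin 2) × EuclideanSpace ℝ (Fin 2) |
          dist p.1 p.2 < Real.sqrt t}.indicator (fun p => W p.1 * e p.2) (z, c) := by
        rw [lintegral_const_mul' _ _ ENNReal.ofReal_ne_top, lintegral_lintegral_swap]
        exact (Measurable.indicator (by fun_prop) hS).aemeasurable
    _ = K * ∫⁻ c, e c * ∫⁻ z in Metric.ball c (Real.sqrt t), W z := by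
        congr 1
        refine lintegral_congr fun c => ?_
        rw [← lintegral_const_mul _ hW, ← lintegral_indicator measurableSet_ball]
        refine lintegral_congr fun z => ?_
        by_cases h : dist z c < Real.sqrt t
        · rw [Set.indicator_of_mem (Metric.mem_ball.2 h), Set.indicator_of_mem (by exact h),
            mul_comm]
        · rw [Set.indicator_of_notMem (mt Metric.mem_ball.1 h),
            Set.indicator_of_notMem (by exact h)]
    _ ≤ K * ∫⁻ c, e c * M := by
        gcongr with c
        exact hM c
    _ = ENNReal.ofReal (16 * Real.exp 1) * M := by
        rw [lintegral_mul_const _ hem, lintegral_exp_neg_mul_norm_sub_sq ht x, ← mul_assoc, hK,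
          ← ENNReal.ofReal_mul (by positivity)]
        congr 2
        field_simp

lemma lintegral_gauss_mul_abs_eq (d : ℕ) {V : EuclideanSpace ℝ (Fin d) → ℝ} (hV : Measurable V)
    (t : ℝ) (x : EuclideanSpace ℝ (Fin d)) :
    ∫⁻ s in Set.Ioo 0 t, ∫⁻ z, ENNReal.ofReal (gauss d s x z * |V z|) =
      ∫⁻ z, ENNReal.ofReal |V z| * ∫⁻ s in Set.Ioo 0 t, ENNReal.ofReal (gauss d s x z) := by
  have hg := measurable_gauss d x
  rw [lintegral_lintegral_swap]
  · refine lintegral_congr fun z => ?_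
    rw [← lintegral_const_mul' _ _ ENNReal.ofReal_ne_top]
    refine lintegral_congr fun s => ?_
    rw [ENNReal.ofReal_mul' (abs_nonneg _), mul_comm]
  · exact Measurable.aemeasurable (f := fun p : ℝ × EuclideanSpace ℝ (Fin d) =>
      ENNReal.ofReal (gauss d p.1 x p.2 * |V p.2|)) (by fun_prop)

theorem stmt12 :
    ∃ C₁ C₂ : ℝ, 0 < C₁ ∧ 0 < C₂ ∧
    ∀ t : ℝ, 0 < t → ∀ V : EuclideanSpace ℝ (Fin 2) → ℝ, Measurable V →
      ENNReal.ofReal C₁ * katoA 2 V t ≤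
        (⨆ x, ∫⁻ z in {z : EuclideanSpace ℝ (Fin 2) | ‖z - x‖ < Real.sqrt (4 * t)},
          ENNReal.ofReal (|V z| * Real.log (4 * t / ‖z - x‖ ^ 2))) ∧
      (⨆ x, ∫⁻ z in {z : EuclideanSpace ℝ (Fin 2) | ‖z - x‖ < Real.sqrt (4 * t)},
          ENNReal.ofReal (|V z| * Real.log (4 * t / ‖z - x‖ ^ 2))) ≤
        ENNReal.ofReal C₂ * katoA 2 V t := by
  have hC : 0 < 2 + 128 * Real.exp 1 := by positivity
  refine ⟨(2 + 128 * Real.exp 1)⁻¹, 4 * Real.pi * Real.exp 1, by positivity, by positivity,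
    fun t ht V hV => ⟨?_, ?_⟩⟩
  · set M := ⨆ x, ∫⁻ z in {z : EuclideanSpace ℝ (Fin 2) | ‖z - x‖ < Real.sqrt (4 * t)},
      ENNReal.ofReal (|V z| * Real.log (4 * t / ‖z - x‖ ^ 2)) with hMdef
    have hM (x) : ∫⁻ z in {z : EuclideanSpace ℝ (Fin 2) | ‖z - x‖ < Real.sqrt (4 * t)},
        ENNReal.ofReal (|V z| * Real.log (4 * t / ‖z - x‖ ^ 2)) ≤ M :=
      le_iSup (fun x => ∫⁻ z in {z : EuclideanSpace ℝ (Fin 2) | ‖z - x‖ < Real.sqrt (4 * t)},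
        ENNReal.ofReal (|V z| * Real.log (4 * t / ‖z - x‖ ^ 2))) x
    have hset (x : EuclideanSpace ℝ (Fin 2)) :
        MeasurableSet {z : EuclideanSpace ℝ (Fin 2) | ‖z - x‖ < Real.sqrt (4 * t)} :=
      measurableSet_lt (by fun_prop) measurable_const
    have hball (c) : ∫⁻ z in Metric.ball c (Real.sqrt t), ENNReal.ofReal |V z| ≤ M := by
      refine le_trans ?_ (hM c)
      have hsub : Metric.ball c (Real.sqrt t) ⊆
          {z : EuclideanSpace ℝ (Fin 2) | ‖z - c‖ < Real.sqrt (4 * t)} := fun z hz => by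
        rw [mem_ball_iff_norm] at hz
        exact hz.trans_le (Real.sqrt_le_sqrt (by linarith))
      refine le_trans ?_ (lintegral_mono_set hsub)
      refine setLIntegral_mono_ae' measurableSet_ball ?_
      filter_upwards [compl_mem_ae_iff.2 (measure_singleton c)] with z hzc hz
      have hpos : 0 < ‖z - c‖ := norm_pos_iff.2 (sub_ne_zero.2 hzc)
      rw [mem_ball_iff_norm, Real.lt_sqrt hpos.le] at hz
      refine ENNReal.ofReal_le_ofReal (le_mul_of_one_le_right (abs_nonneg _) ?_)
      rw [Real.le_log_iff_exp_le (by positivity), le_div_iff₀ (by positivity)]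
      nlinarith [Real.exp_one_lt_d9]
    have key (x) : ∫⁻ s in Set.Ioo 0 t, ∫⁻ z, ENNReal.ofReal (gauss 2 s x z * |V z|) ≤
        ENNReal.ofReal (2 + 128 * Real.exp 1) * M := by
      rw [lintegral_gauss_mul_abs_eq 2 hV]
      calc ∫⁻ z, ENNReal.ofReal |V z| * ∫⁻ s in Set.Ioo 0 t, ENNReal.ofReal (gauss 2 s x z)
          ≤ ∫⁻ z, (2 * {z : EuclideanSpace ℝ (Fin 2) | ‖z - x‖ < Real.sqrt (4 * t)}.indicator
                (fun z => ENNReal.ofReal (|V z| * Real.log (4 * t / ‖z - x‖ ^ 2))) z +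
              8 * (ENNReal.ofReal |V z| *
                ENNReal.ofReal (Real.exp (-‖z - x‖ ^ 2 / (8 * t))))) := by
            refine lintegral_mono_ae ?_
            filter_upwards [compl_mem_ae_iff.2 (measure_singleton x)] with z hzx
            have hpos : 0 < ‖z - x‖ := norm_pos_iff.2 (sub_ne_zero.2 hzx)
            rcases lt_or_ge (‖z - x‖ ^ 2) t with h | h
            · refine le_add_right ?_
              have hmem : z ∈ {z : EuclideanSpace ℝ (Fin 2) | ‖z - x‖ < Real.sqrt (4 * t)} :=
                (Real.lt_sqrt hpos.le).2 (by linarith)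
              rw [Set.indicator_of_mem hmem, ENNReal.ofReal_mul (abs_nonneg _), mul_left_comm]
              gcongr
              exact lintegral_gauss_le_log x z hpos h
            · refine le_add_left ?_
              rw [mul_left_comm]
              gcongr
              exact lintegral_gauss_le_exp ht x z h
        _ ≤ 2 * M + 8 * (ENNReal.ofReal (16 * Real.exp 1) * M) := by
            have hind : Measurable
                ({z : EuclideanSpace ℝ (Fin 2) | ‖z - x‖ < Real.sqrt (4 * t)}.indicator
                  fun z => ENNReal.ofReal (|V z| * Real.log (4 * t / ‖z - x‖ ^ 2))) :=
              Measurable.indicator (by fun_prop) (hset x)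
            rw [lintegral_add_left (hind.const_mul 2), lintegral_const_mul _ hind,
              lintegral_const_mul _ (by fun_prop), lintegral_indicator (hset x)]
            gcongr
            · exact hM x
            · exact lintegral_mul_exp_le ht (by fun_prop) hball x
        _ = _ := by
            rw [← mul_assoc, ← add_mul, ENNReal.ofReal_add (by norm_num) (by positivity),
              ← ENNReal.ofReal_ofNat 8, ← ENNReal.ofReal_mul (by norm_num), ← mul_assoc,
              ENNReal.ofReal_ofNat 2]
            norm_num
    calc _ ≤ ENNReal.ofReal (2 + 128 * Real.exp 1)⁻¹ *
          (ENNReal.ofReal (2 + 128 * Real.exp 1) * M) := by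
          gcongr
          exact iSup_le key
      _ = M := by
          rw [← mul_assoc, ← ENNReal.ofReal_mul (by positivity), inv_mul_cancel₀ hC.ne',
            ENNReal.ofReal_one, one_mul]
  · refine iSup_le fun x => ?_
    calc _ ≤ ∫⁻ z in {z : EuclideanSpace ℝ (Fin 2) | ‖z - x‖ < Real.sqrt (4 * t)},
          ENNReal.ofReal (4 * Real.pi * Real.exp 1) * (ENNReal.ofReal |V z| *
            ∫⁻ s in Set.Ioo 0 t, ENNReal.ofReal (gauss 2 s x z)) := by
          refine setLIntegral_mono' (measurableSet_lt (by fun_prop) measurable_const)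
            fun z hz => ?_
          rw [ENNReal.ofReal_mul (abs_nonneg _), mul_left_comm]
          gcongr
          exact ofReal_log_le_lintegral_gauss ht x z hz
      _ ≤ _ := setLIntegral_le_lintegral _ _
      _ = ENNReal.ofReal (4 * Real.pi * Real.exp 1) *
          ∫⁻ s in Set.Ioo 0 t, ∫⁻ z, ENNReal.ofReal (gauss 2 s x z * |V z|) := by
          rw [lintegral_const_mul' _ _ ENNReal.ofReal_ne_top, lintegral_gauss_mul_abs_eq 2 hV]
      _ ≤ _ := by
          gcongr
          exact le_iSup (fun x => ∫⁻ s in Set.Ioo 0 t, ∫⁻ z,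
            ENNReal.ofReal (gauss 2 s x z * |V z|)) x
end
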